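/- arXiv:2105.12220 — 2 statements merged into one kernel-verified Lean document; each statement's English description precedes it below -/
import Mathlib

section
/- Let X_0 → X_1 → ⋯ and Y_0 → Y_1 → ⋯ be two sequences of core-compact topological spaces with continuous injective transition maps. Then the canonical continuous bijection from the sequential colimit ⋃_{n<ω} (X_n × Y_n) (with the colimit topology) to the product (⋃_{n<ω} X_n) × (⋃_{n<ω} Y_n) of the colimits (with the product topology) is a homeomorphism. Concretely: let X and Y be sets, let (X_n) and (Y_n) be increasing sequences of subsets with ⋃_n X_n = X and ⋃_n Y_n = Y, each X_n and Y_n equipped with a core-compact topology such that each inclusion X_n → X_{n+1} and Y_n → Y_{n+1} is continuous; equip X, Y with the final topologies (U open iff U ∩ X_n open in X_n for all n, and similarly for Y), and equip X × Y both with the product topology and with the final topology coming from the subsets X_n × Y_n (each with the product topology of X_n and Y_n). Then these two topologies on X × Y coincide. -/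
/-- `S` is way below `T` with respect to an explicitly given topology. -/
def WayBelowT {X : Type} (tX : TopologicalSpace X) (S T : Set X) : Prop :=
  ∀ (ι : Type) (U : ι → Set X), (∀ i, tX.IsOpen (U i)) → T ⊆ ⋃ i, U i →
    ∃ J : Finset ι, S ⊆ ⋃ i ∈ J, U i

/-- Core-compactness with respect to an explicitly given topology. -/
def IsCoreCompactT {X : Type} (tX : TopologicalSpace X) : Prop :=
  ∀ (x : X) (U : Set X), tX.IsOpen U → x ∈ U →
    ∃ V : Set X, tX.IsOpen V ∧ x ∈ V ∧ WayBelowT tX V U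

open scoped Topology

namespace WayBelowT

variable {X Y : Type} {tX : TopologicalSpace X} {tY : TopologicalSpace Y}

theorem mono {S S' T T' : Set X} (h : WayBelowT tX S T) (hS : S' ⊆ S) (hT : T ⊆ T') :
    WayBelowT tX S' T' := fun ι U hU hc =>
  (h ι U hU (hT.trans hc)).imp fun _ hJ => hS.trans hJ

theorem subset {S T : Set X} (h : WayBelowT tX S T) (hT : IsOpen T) : S ⊆ T := by
  obtain ⟨J, hJ⟩ := h Unit (fun _ => T) (fun _ => hT) (Set.subset_iUnion (fun _ : Unit => T) ())
  exact hJ.trans (Set.iUnion₂_subset fun _ _ => subset_rfl)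

theorem image {f : X → Y} (hf : Continuous f) {S T : Set X} (h : WayBelowT tX S T) :
    WayBelowT tY (f '' S) (f '' T) := by
  intro ι U hU hc
  obtain ⟨J, hJ⟩ := h ι (fun i => f ⁻¹' U i) (fun i => IsOpen.preimage hf (hU i)) (by
    rw [← Set.preimage_iUnion]
    exact Set.image_subset_iff.1 hc)
  refine ⟨J, ?_⟩
  rw [Set.image_subset_iff]
  simpa only [Set.preimage_iUnion] using hJ

theorem biUnion {κ : Type} (J : Finset κ) {V : κ → Set X} {T : Set X}
    (h : ∀ i ∈ J, WayBelowT tX (V i) T) : WayBelowT tX (⋃ i ∈ J, V i) T := by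
  classical
  intro ι U hU hc
  choose! F hF using fun i hi => h i hi ι U hU hc
  refine ⟨J.biUnion F, Set.iUnion₂_subset fun i hi => (hF i hi).trans ?_⟩
  exact Set.biUnion_subset_biUnion_left fun j hj => Finset.mem_biUnion.2 ⟨i, hi, hj⟩

theorem interpolate (hX : IsCoreCompactT tX) {S P : Set X} (hP : IsOpen P)
    (h : WayBelowT tX S P) :
    ∃ M N : Set X, IsOpen M ∧ IsOpen N ∧ S ⊆ M ∧ WayBelowT tX M N ∧ WayBelowT tX N P := by
  obtain ⟨J, hJ⟩ := h {V : Set X × Set X // IsOpen V.1 ∧ IsOpen V.2 ∧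
      WayBelowT tX V.1 V.2 ∧ WayBelowT tX V.2 P} (fun V => V.1.1) (fun V => V.2.1) (by
    intro x hx
    obtain ⟨V, hV, hxV, hVP⟩ := hX x P hP hx
    obtain ⟨V', hV', hxV', hVV'⟩ := hX x V hV hxV
    exact Set.mem_iUnion.2 ⟨⟨(V', V), hV', hV, hVV', hVP⟩, hxV'⟩)
  refine ⟨⋃ i ∈ J, i.1.1, ⋃ i ∈ J, i.1.2, isOpen_biUnion fun i _ => i.2.1,
    isOpen_biUnion fun i _ => i.2.2.1, hJ, biUnion J fun i hi => ?_,
    biUnion J fun i _ => i.2.2.2.2⟩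
  exact i.2.2.2.1.mono subset_rfl (Set.subset_biUnion_of_mem (u := fun i => i.1.2) hi)

/-- If every point of `P` has an open neighbourhood `R` with `R ×ˢ N ⊆ W` for some `N` in a family
closed under finite intersections, then so does every set way below `P`. -/
theorem exists_open_of_forall_mem {S P : Set X} (h : WayBelowT tX S P)
    (p : Set Y → Prop) (h_univ : p Set.univ) (h_inter : ∀ s t, p s → p t → p (s ∩ t))
    (W : Set (X × Y))
    (hW : ∀ x ∈ P, ∃ R N, IsOpen R ∧ x ∈ R ∧ p N ∧ R ×ˢ N ⊆ W) :
    ∃ R N, IsOpen R ∧ S ⊆ R ∧ p N ∧ R ×ˢ N ⊆ W := by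
  classical
  obtain ⟨J, hJ⟩ := h {V : Set X × Set Y // IsOpen V.1 ∧ p V.2 ∧ V.1 ×ˢ V.2 ⊆ W}
    (fun V => V.1.1) (fun V => V.2.1) (by
      intro x hx
      obtain ⟨R, N, hR, hxR, hN, hRN⟩ := hW x hx
      exact Set.mem_iUnion.2 ⟨⟨(R, N), hR, hN, hRN⟩, hxR⟩)
  refine ⟨⋃ i ∈ J, i.1.1, ⋂ i ∈ J, i.1.2, isOpen_biUnion fun i _ => i.2.1, hJ, ?_, ?_⟩
  · clear hJ
    induction J using Finset.induction_on with
    | empty => simpa using h_univ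
    | insert a s _ ih =>
      rw [Finset.set_biInter_insert]
      exact h_inter _ _ a.2.2.1 ih
  · rintro ⟨x, y⟩ ⟨hx, hy⟩
    simp only [Set.mem_iUnion, Set.mem_iInter] at hx hy
    obtain ⟨i, hi, hx⟩ := hx
    exact i.2.2.2 ⟨hx, hy i hi⟩

theorem exists_open_prod_subset {S P : Set X} {T Q : Set Y} (hS : WayBelowT tX S P)
    (hT : WayBelowT tY T Q) {W : Set (X × Y)} (hW : IsOpen W) (hPQ : P ×ˢ Q ⊆ W) :
    ∃ R N, IsOpen R ∧ IsOpen N ∧ S ⊆ R ∧ T ⊆ N ∧ R ×ˢ N ⊆ W := by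
  have slice (x : X) (hx : x ∈ P) :
      ∃ N R, IsOpen N ∧ T ⊆ N ∧ (IsOpen R ∧ x ∈ R) ∧ N ×ˢ R ⊆ Prod.swap ⁻¹' W := by
    refine hT.exists_open_of_forall_mem (fun R => IsOpen R ∧ x ∈ R) ⟨isOpen_univ, trivial⟩
      (fun s t hs ht => ⟨hs.1.inter ht.1, hs.2, ht.2⟩) _ fun y hy => ?_
    obtain ⟨R, N, hR, hN, hx, hy, hRN⟩ := isOpen_prod_iff.1 hW x y (hPQ ⟨hx, hy⟩)
    exact ⟨N, R, hN, hy, ⟨hR, hx⟩, fun z hz => hRN ⟨hz.2, hz.1⟩⟩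
  obtain ⟨R, N, hR, hSR, ⟨hN, hTN⟩, hRN⟩ :=
    hS.exists_open_of_forall_mem (fun N => IsOpen N ∧ T ⊆ N) ⟨isOpen_univ, Set.subset_univ _⟩
      (fun s t hs ht => ⟨hs.1.inter ht.1, Set.subset_inter hs.2 ht.2⟩) W fun x hx => by
        obtain ⟨N, R, hN, hTN, ⟨hR, hxR⟩, hNR⟩ := slice x hx
        exact ⟨R, N, hR, hxR, ⟨hN, hTN⟩, fun z hz => hNR (a := z.swap) ⟨hz.2, hz.1⟩⟩
  exact ⟨R, N, hR, hN, hSR, hTN, hRN⟩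

end WayBelowT

/-- The rectangle `S ×ˢ T` is open and sits way below an open rectangle contained in `W`. -/
def IsInnerRect {X Y : Type} (tX : TopologicalSpace X) (tY : TopologicalSpace Y)
    (W : Set (X × Y)) (S : Set X) (T : Set Y) : Prop :=
  IsOpen S ∧ IsOpen T ∧ ∃ P Q, IsOpen P ∧ IsOpen Q ∧ WayBelowT tX S P ∧ WayBelowT tY T Q ∧
    P ×ˢ Q ⊆ W

namespace IsInnerRect

variable {X Y X' Y' : Type} {tX : TopologicalSpace X} {tY : TopologicalSpace Y}
  {tX' : TopologicalSpace X'} {tY' : TopologicalSpace Y'}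

theorem exists_of_mem (hX : IsCoreCompactT tX) (hY : IsCoreCompactT tY) {W : Set (X × Y)}
    (hW : IsOpen W) {x : X} {y : Y} (h : (x, y) ∈ W) :
    ∃ S T, IsInnerRect tX tY W S T ∧ x ∈ S ∧ y ∈ T := by
  obtain ⟨P, Q, hP, hQ, hx, hy, hPQ⟩ := isOpen_prod_iff.1 hW x y h
  obtain ⟨S, hS, hxS, hSP⟩ := hX x P hP hx
  obtain ⟨T, hT, hyT, hTQ⟩ := hY y Q hQ hy
  exact ⟨S, T, ⟨hS, hT, P, Q, hP, hQ, hSP, hTQ, hPQ⟩, hxS, hyT⟩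

theorem exists_extend (hX : IsCoreCompactT tX) (hY : IsCoreCompactT tY)
    (hX' : IsCoreCompactT tX') (hY' : IsCoreCompactT tY') {f : X → X'} {g : Y → Y'}
    (hf : Continuous f) (hg : Continuous g) {W : Set (X × Y)} {W' : Set (X' × Y')}
    (hW' : IsOpen W') (hWW' : Set.MapsTo (Prod.map f g) W W') {S : Set X} {T : Set Y}
    (h : IsInnerRect tX tY W S T) :
    ∃ S' T', IsInnerRect tX' tY' W' S' T' ∧ f '' S ⊆ S' ∧ g '' T ⊆ T' := by
  obtain ⟨-, -, P, Q, hP, hQ, hSP, hTQ, hPQ⟩ := h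
  obtain ⟨M, N, -, -, hSM, hMN, hNP⟩ := hSP.interpolate hX hP
  obtain ⟨K, L, -, -, hTK, hKL, hLQ⟩ := hTQ.interpolate hY hQ
  obtain ⟨P', Q', hP', hQ', hNP', hLQ', hPQ'⟩ :=
    (hNP.image hf).exists_open_prod_subset (hLQ.image hg) hW' (by
      rintro ⟨_, _⟩ ⟨⟨x, hx, rfl⟩, ⟨y, hy, rfl⟩⟩
      exact hWW' (hPQ (Set.mk_mem_prod hx hy)))
  obtain ⟨S', S'', hS', hS'', hSS', hSS'', hSP'⟩ :=
    ((hMN.image hf).mono (Set.image_mono hSM) hNP').interpolate hX' hP'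
  obtain ⟨T', T'', hT', hT'', hTT', hTT'', hTQ'⟩ :=
    ((hKL.image hg).mono (Set.image_mono hTK) hLQ').interpolate hY' hQ'
  exact ⟨S', T', ⟨hS', hT', P', Q', hP', hQ',
    hSP'.mono (hSS''.subset hS'') subset_rfl, hTQ'.mono (hTT''.subset hT'') subset_rfl, hPQ'⟩, hSS', hTT'⟩

theorem prod_subset {W : Set (X × Y)} {S : Set X} {T : Set Y} (h : IsInnerRect tX tY W S T) :
    S ×ˢ T ⊆ W := by
  obtain ⟨-, -, P, Q, hP, hQ, hSP, hTQ, hPQ⟩ := h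
  exact (Set.prod_mono (hSP.subset hP) (hTQ.subset hQ)).trans hPQ

end IsInnerRect

theorem continuous_inclusion_of_le {α : Type} {A : ℕ → Set α} (hA : ∀ n, A n ⊆ A (n + 1))
    (tA : ∀ n, TopologicalSpace (A n))
    (hAcont : ∀ n, @Continuous (A n) (A (n + 1)) (tA n) (tA (n + 1)) (Set.inclusion (hA n)))
    {m n : ℕ} (h : m ≤ n) :
    @Continuous (A m) (A n) (tA m) (tA n) (Set.inclusion (monotone_nat_of_le_succ hA h)) := by
  induction n, h using Nat.le_induction with
  | base => exact continuous_id
  | succ n h ih => exact (hAcont n).comp ih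

theorem isOpen_iSup_coinduced_iff {α : Type} {ι : Type} {Z : ι → Type}
    (t : ∀ i, TopologicalSpace (Z i)) (f : ∀ i, Z i → α) {U : Set α} :
    IsOpen[⨆ i, TopologicalSpace.coinduced (f i) (t i)] U ↔ ∀ i, IsOpen[t i] (f i ⁻¹' U) := by
  simp only [isOpen_iSup_iff, isOpen_coinduced]

/-- An increasing union of sets `U k`, each open in the stage `A (N + k)`, is open in the colimit. -/
theorem isOpen_iUnion_of_eventually_isOpen {α : Type} {A : ℕ → Set α}
    (hA : ∀ n, A n ⊆ A (n + 1)) (tA : ∀ n, TopologicalSpace (A n))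
    (hAcont : ∀ n, @Continuous (A n) (A (n + 1)) (tA n) (tA (n + 1)) (Set.inclusion (hA n)))
    {N : ℕ} {U : ℕ → Set α} (hU : Monotone U)
    (hUo : ∀ k, IsOpen[tA (N + k)] ((↑) ⁻¹' U k : Set (A (N + k)))) :
    IsOpen[⨆ n, TopologicalSpace.coinduced (Subtype.val : A n → α) (tA n)] (⋃ k, U k) := by
  rw [isOpen_iSup_coinduced_iff]
  intro n
  have key : (Subtype.val : A n → α) ⁻¹' (⋃ k, U k) =
      ⋃ k, (Subtype.val : A n → α) ⁻¹' U (n + k) := by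
    rw [← Set.preimage_iUnion]
    congr 1
    refine subset_antisymm (Set.iUnion_mono fun k => hU (Nat.le_add_left k n))
      (Set.iUnion_subset fun k => Set.subset_iUnion U (n + k))
  rw [key]
  exact @isOpen_iUnion _ _ (tA n) _ fun k => (hUo (n + k)).preimage
    (continuous_inclusion_of_le hA tA hAcont (show n ≤ N + (n + k) by omega))

/-- A countable increasing union of core-compact spaces (with continuous
injective transition maps) commutes with binary products: the product of the
colimit topologies coincides with the colimit of the product topologies. -/
theorem colimit_prod_eq_prod_colimit {α β : Type}
    (A : ℕ → Set α) (B : ℕ → Set β)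
    (hA : ∀ n, A n ⊆ A (n + 1)) (hB : ∀ n, B n ⊆ B (n + 1))
    (hAU : ⋃ n, A n = Set.univ) (hBU : ⋃ n, B n = Set.univ)
    (tA : ∀ n, TopologicalSpace (A n)) (tB : ∀ n, TopologicalSpace (B n))
    (hAcc : ∀ n, IsCoreCompactT (tA n)) (hBcc : ∀ n, IsCoreCompactT (tB n))
    (hAcont : ∀ n, @Continuous (A n) (A (n + 1)) (tA n) (tA (n + 1))
      (Set.inclusion (hA n)))
    (hBcont : ∀ n, @Continuous (B n) (B (n + 1)) (tB n) (tB (n + 1))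
      (Set.inclusion (hB n)))
    -- the colimit (final) topologies on `α` and `β`
    (TA : TopologicalSpace α) (TB : TopologicalSpace β)
    (hTA : TA = ⨆ n, TopologicalSpace.coinduced (Subtype.val : A n → α) (tA n))
    (hTB : TB = ⨆ n, TopologicalSpace.coinduced (Subtype.val : B n → β) (tB n)) :
    -- the product of the colimit topologies equals the colimit of the
    -- product topologies on the pieces `A n × B n`
    @instTopologicalSpaceProd α β TA TB =
      ⨆ n, TopologicalSpace.coinduced
        (fun p : A n × B n => ((p.1 : α), (p.2 : β)))
        (@instTopologicalSpaceProd (A n) (B n) (tA n) (tB n)) := by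
  refine le_antisymm ?_ (iSup_le fun n => ?_)
  · intro W hW
    have hWn := (isOpen_iSup_coinduced_iff _ _).1 hW
    rw [isOpen_prod_iff]
    intro a b hab
    obtain ⟨i, hi⟩ := Set.mem_iUnion.1 (hAU ▸ Set.mem_univ a)
    obtain ⟨j, hj⟩ := Set.mem_iUnion.1 (hBU ▸ Set.mem_univ b)
    set N := max i j
    have ha : a ∈ A N := monotone_nat_of_le_succ hA (le_max_left i j) hi
    have hb : b ∈ B N := monotone_nat_of_le_succ hB (le_max_right i j) hj
    let Good (n : ℕ) (s : Set α × Set β) : Prop :=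
      ∃ S T, IsInnerRect (tA n) (tB n) ((fun p : A n × B n => ((p.1 : α), (p.2 : β))) ⁻¹' W) S T ∧
        s = (Subtype.val '' S, Subtype.val '' T)
    have step (n : ℕ) (s : Set α × Set β) (hs : Good n s) :
        ∃ s', Good (n + 1) s' ∧ s ≤ s' := by
      obtain ⟨S, T, h, rfl⟩ := hs
      obtain ⟨S', T', h', hS, hT⟩ := h.exists_extend (hAcc n) (hBcc n) (hAcc (n + 1))
        (hBcc (n + 1)) (hAcont n) (hBcont n) (hWn (n + 1)) (fun _ hp => hp)
      refine ⟨_, ⟨S', T', h', rfl⟩, ?_, ?_⟩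
      · rintro _ ⟨x, hx, rfl⟩
        exact ⟨_, hS ⟨x, hx, rfl⟩, rfl⟩
      · rintro _ ⟨x, hx, rfl⟩
        exact ⟨_, hT ⟨x, hx, rfl⟩, rfl⟩
    choose! F hF using step
    obtain ⟨S₀, T₀, h₀, haS, hbT⟩ := IsInnerRect.exists_of_mem (hAcc N) (hBcc N) (hWn N)
      (x := ⟨a, ha⟩) (y := ⟨b, hb⟩) hab
    let s (k : ℕ) : Set α × Set β :=
      Nat.rec (Subtype.val '' S₀, Subtype.val '' T₀) (fun k s => F (N + k) s) k
    have hs (k : ℕ) : Good (N + k) (s k) := by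
      induction k with
      | zero => exact ⟨S₀, T₀, h₀, rfl⟩
      | succ k ih => exact (hF _ _ ih).1
    have hmono : Monotone s := monotone_nat_of_le_succ fun k => (hF _ _ (hs k)).2
    refine ⟨⋃ k, (s k).1, ⋃ k, (s k).2, ?_, ?_, Set.mem_iUnion.2 ⟨0, ⟨a, ha⟩, haS, rfl⟩,
      Set.mem_iUnion.2 ⟨0, ⟨b, hb⟩, hbT, rfl⟩, ?_⟩
    · rw [hTA]
      refine isOpen_iUnion_of_eventually_isOpen hA tA hAcont (N := N)
        (fun k l h => (hmono h).1) fun k => ?_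
      obtain ⟨S, T, h, hst⟩ := hs k
      rw [hst, Set.preimage_image_eq _ Subtype.val_injective]
      exact h.1
    · rw [hTB]
      refine isOpen_iUnion_of_eventually_isOpen hB tB hBcont (N := N)
        (fun k l h => (hmono h).2) fun k => ?_
      obtain ⟨S, T, h, hst⟩ := hs k
      rw [hst, Set.preimage_image_eq _ Subtype.val_injective]
      exact h.2.1
    · rintro ⟨x, y⟩ ⟨hx, hy⟩
      obtain ⟨k, hx⟩ := Set.mem_iUnion.1 hx
      obtain ⟨l, hy⟩ := Set.mem_iUnion.1 hy
      replace hx := (hmono (le_max_left k l)).1 hx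
      replace hy := (hmono (le_max_right k l)).2 hy
      obtain ⟨S, T, h, hst⟩ := hs (max k l)
      rw [hst] at hx hy
      obtain ⟨x, hxS, rfl⟩ := hx
      obtain ⟨y, hyT, rfl⟩ := hy
      exact h.prod_subset (Set.mk_mem_prod hxS hyT)
  · have hcA : @Continuous _ _ (tA n) TA (Subtype.val : A n → α) := by
      rw [continuous_iff_coinduced_le, hTA]
      exact le_iSup (fun n => TopologicalSpace.coinduced (Subtype.val : A n → α) (tA n)) n
    have hcB : @Continuous _ _ (tB n) TB (Subtype.val : B n → β) := by
      rw [continuous_iff_coinduced_le, hTB]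
      exact le_iSup (fun n => TopologicalSpace.coinduced (Subtype.val : B n → β) (tB n)) n
    exact continuous_iff_coinduced_le.1 (hcA.prodMap hcB)
end

section
/- (Product interpolation lemma.) Let X and Y be core-compact topological spaces, let S ⊆ X and T ⊆ Y be subsets, and let W ⊆ X × Y be an open subset such that S × T ≪ W (way-below in X × Y with the product topology). Then there exist open sets U ⊆ X and V ⊆ Y with S ⊆ U, T ⊆ V, and U × V ≪ W. -/
/-- `S` is way below `T`: every family of open sets whose union contains `T`
admits a finite subfamily whose union contains `S`. -/
def WayBelow {X : Type} [TopologicalSpace X] (S T : Set X) : Prop :=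
  ∀ (ι : Type) (U : ι → Set X), (∀ i, IsOpen (U i)) → T ⊆ ⋃ i, U i →
    ∃ J : Finset ι, S ⊆ ⋃ i ∈ J, U i

/-- A topological space is core-compact if every open neighbourhood of a point
contains an open neighbourhood of that point which is way below it. -/
def IsCoreCompact (X : Type) [TopologicalSpace X] : Prop :=
  ∀ (x : X) (U : Set X), IsOpen U → x ∈ U →
    ∃ V : Set X, IsOpen V ∧ x ∈ V ∧ WayBelow V U

theorem WayBelow.mono {X : Type} [TopologicalSpace X] {S S' T T' : Set X}
    (h : WayBelow S T) (hS : S' ⊆ S) (hT : T ⊆ T') : WayBelow S' T' := by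
  intro ι U hU hTU
  obtain ⟨J, hJ⟩ := h ι U hU (hT.trans hTU)
  exact ⟨J, hS.trans hJ⟩

theorem WayBelow.biUnion_finset {X κ : Type} [TopologicalSpace X] {S : κ → Set X} {T : Set X}
    (F : Finset κ) (h : ∀ k ∈ F, WayBelow (S k) T) : WayBelow (⋃ k ∈ F, S k) T := by
  classical
  intro ι U hU hTU
  have hfin : ∀ k : F, ∃ J : Finset ι, S k ⊆ ⋃ i ∈ J, U i := fun k => h k k.2 ι U hU hTU
  choose J hJ using hfin
  refine ⟨F.attach.biUnion J, Set.iUnion₂_subset fun k hk x hx => ?_⟩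
  obtain ⟨i, hi, hxi⟩ := Set.mem_iUnion₂.1 (hJ ⟨k, hk⟩ hx)
  exact Set.mem_iUnion₂.2
    ⟨i, Finset.mem_biUnion.2 ⟨⟨k, hk⟩, Finset.mem_attach _ _, hi⟩, hxi⟩

theorem WayBelow.prod {X Y : Type} [TopologicalSpace X] [TopologicalSpace Y]
    {A A' : Set X} {B B' : Set Y} (hA : WayBelow A A') (hB : WayBelow B B') :
    WayBelow (A ×ˢ B) (A' ×ˢ B') := by
  classical
  intro ι O hO hcov
  have hbox : ∀ (a : A') (b : B'), ∃ (i : ι) (P : Set X) (Q : Set Y),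
      IsOpen P ∧ IsOpen Q ∧ a.1 ∈ P ∧ b.1 ∈ Q ∧ P ×ˢ Q ⊆ O i := by
    intro a b
    obtain ⟨i, hi⟩ := Set.mem_iUnion.1 (hcov (Set.mk_mem_prod a.2 b.2))
    obtain ⟨P, Q, hP, hQ, ha, hb, hPQ⟩ := isOpen_prod_iff.1 (hO i) a b hi
    exact ⟨i, P, Q, hP, hQ, ha, hb, hPQ⟩
  choose i P Q hP hQ ha hb hPQ using hbox
  have hslice : ∀ a : A', ∃ J : Finset B', B ⊆ ⋃ b ∈ J, Q a b := fun a =>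
    hB B' (Q a) (hQ a) fun b hb' => Set.mem_iUnion.2 ⟨⟨b, hb'⟩, hb a ⟨b, hb'⟩⟩
  choose J hJ using hslice
  obtain ⟨K, hK⟩ := hA A' (fun a => ⋂ b ∈ J a, P a b)
    (fun a => isOpen_biInter_finset fun b _ => hP a b)
    (fun a ha' => Set.mem_iUnion.2 ⟨⟨a, ha'⟩, Set.mem_iInter₂.2 fun b _ => ha ⟨a, ha'⟩ b⟩)
  refine ⟨K.biUnion fun a => (J a).image (i a), ?_⟩
  rintro ⟨x, y⟩ ⟨hx, hy⟩
  obtain ⟨a, haK, hxa⟩ := Set.mem_iUnion₂.1 (hK hx)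
  obtain ⟨b, hbJ, hyb⟩ := Set.mem_iUnion₂.1 (hJ a hy)
  exact Set.mem_iUnion₂.2 ⟨i a b,
    Finset.mem_biUnion.2 ⟨a, haK, Finset.mem_image_of_mem _ hbJ⟩,
    hPQ a b ⟨Set.mem_iInter₂.1 hxa b hbJ, hyb⟩⟩

/-- A rectangle covered by finitely many open boxes is contained in an open rectangle covered by
the same boxes. -/
theorem exists_isOpen_prod_subset_biUnion_prod {X Y κ : Type} [TopologicalSpace X]
    [TopologicalSpace Y] {S : Set X} {T : Set Y} {A : κ → Set X} {B : κ → Set Y}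
    (hA : ∀ k, IsOpen (A k)) (hB : ∀ k, IsOpen (B k)) (F : Finset κ)
    (hST : S ×ˢ T ⊆ ⋃ k ∈ F, A k ×ˢ B k) :
    ∃ (U : Set X) (V : Set Y), IsOpen U ∧ IsOpen V ∧ S ⊆ U ∧ T ⊆ V ∧
      U ×ˢ V ⊆ ⋃ k ∈ F, A k ×ˢ B k := by
  classical
  let I : X → Finset κ := fun x => F.filter fun k => x ∈ A k
  have hfin : (I '' S).Finite :=
    F.powerset.finite_toSet.subset <| by
      rintro _ ⟨x, -, rfl⟩
      exact Finset.mem_coe.2 (Finset.mem_powerset.2 (Finset.filter_subset _ _))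
  refine ⟨⋃ x ∈ S, ⋂ k ∈ I x, A k, ⋂ G ∈ I '' S, ⋃ k ∈ G, B k,
    isOpen_biUnion fun x _ => isOpen_biInter_finset fun k _ => hA k,
    hfin.isOpen_biInter fun G _ => isOpen_biUnion fun k _ => hB k, ?_, ?_, ?_⟩
  · intro x hx
    exact Set.mem_iUnion₂.2 ⟨x, hx, Set.mem_iInter₂.2 fun k hk => (Finset.mem_filter.1 hk).2⟩
  · intro y hy
    refine Set.mem_iInter₂.2 ?_
    rintro _ ⟨x, hx, rfl⟩
    obtain ⟨k, hk, hxk, hyk⟩ := Set.mem_iUnion₂.1 (hST (Set.mk_mem_prod hx hy))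
    exact Set.mem_iUnion₂.2 ⟨k, Finset.mem_filter.2 ⟨hk, hxk⟩, hyk⟩
  · rintro ⟨x, y⟩ ⟨hx, hy⟩
    obtain ⟨s, hs, hxs⟩ := Set.mem_iUnion₂.1 hx
    obtain ⟨k, hk, hyk⟩ := Set.mem_iUnion₂.1
      (Set.mem_iInter₂.1 hy (I s) (Set.mem_image_of_mem I hs))
    exact Set.mem_iUnion₂.2
      ⟨k, (Finset.mem_filter.1 hk).1, Set.mem_iInter₂.1 hxs k hk, hyk⟩

/-- Product interpolation lemma. -/
theorem product_interpolation {X Y : Type} [TopologicalSpace X] [TopologicalSpace Y]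
    (hX : IsCoreCompact X) (hY : IsCoreCompact Y)
    (S : Set X) (T : Set Y) (W : Set (X × Y)) (hW : IsOpen W)
    (hST : WayBelow (S ×ˢ T) W) :
    ∃ (U : Set X) (V : Set Y), IsOpen U ∧ IsOpen V ∧ S ⊆ U ∧ T ⊆ V ∧
      WayBelow (U ×ˢ V) W := by
  have hbox : ∀ p : W, ∃ (A : Set X) (B : Set Y),
      IsOpen A ∧ IsOpen B ∧ p.1 ∈ A ×ˢ B ∧ WayBelow (A ×ˢ B) W := by
    rintro ⟨⟨x, y⟩, hp⟩
    obtain ⟨A', B', hA', hB', hx, hy, hAB⟩ := isOpen_prod_iff.1 hW x y hp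
    obtain ⟨A, hA, hxA, hAA'⟩ := hX x A' hA' hx
    obtain ⟨B, hB, hyB, hBB'⟩ := hY y B' hB' hy
    exact ⟨A, B, hA, hB, ⟨hxA, hyB⟩, (hAA'.prod hBB').mono subset_rfl hAB⟩
  choose A B hA hB hmem hway using hbox
  obtain ⟨F, hF⟩ := hST W (fun p => A p ×ˢ B p) (fun p => (hA p).prod (hB p))
    fun p hp => Set.mem_iUnion.2 ⟨⟨p, hp⟩, hmem ⟨p, hp⟩⟩
  obtain ⟨U, V, hU, hV, hSU, hTV, hUV⟩ := exists_isOpen_prod_subset_biUnion_prod hA hB F hF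
  exact ⟨U, V, hU, hV, hSU, hTV,
    (WayBelow.biUnion_finset F fun p _ => hway p).mono hUV subset_rfl⟩
end
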